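/- Fix β ∈ ℝ and smooth functions a, b₁ : ℝ → ℝ all of whose derivatives satisfy |D_y^ℓ a(y)| + |D_y^ℓ b₁(y)| ≤ C_{Nℓ} e^{-N|y|} for every N, ℓ; set b = b₀ + b₁ (b₀ constant), δ(y) = (3/8)β a(y)², φ(ρ,y) = ρ + δ(y) ln ρ + b(y), and let L₀ act for each fixed y by L₀W = ∂_ρ²W + (1 + 1/(4ρ²) + 8δ(y) ρ^{-1} cos²φ) W. Say a function Σ(ρ,y) belongs to the class S_k if it is a finite sum Σ_{n=0}^{N} Σ_{i ≤ I, j ≥ k} ( a_{ijn}(y) cos nφ + b_{ijn}(y) sin nφ ) (ln^i ρ)/ρ^j whose smooth coefficients satisfy |D_y^ℓ a_{ijn}| + |D_y^ℓ b_{ijn}| ≤ C_{Nℓ} e^{-N|y|} for all N, ℓ, and to the subclass S°_k if moreover a_{ik1} = b_{ik1} = 0 for all i (no resonant n = 1 terms at the lowest power j = k). Then for every k ≥ 1 and every Σ° ∈ S°_k there exist Σ_k ∈ S_k and Σ°' ∈ S°_{k+1} such that L₀ Σ_k = Σ° + Σ°'. -/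

import Mathlib

open Real

/-- A smooth function on `ℝ` all of whose derivatives decay faster than any
exponential: `|D^ℓ f(y)| ≤ C_{Nℓ} e^{-N|y|}` for all `N, ℓ`. -/
def ExpDecayAll (f : ℝ → ℝ) : Prop :=
  ContDiff ℝ (⊤ : ℕ∞) f ∧ ∀ N l : ℕ, ∃ C : ℝ, ∀ y : ℝ,
    |iteratedDeriv l f y| ≤ C * Real.exp (-(N : ℝ) * |y|)

/-- The class `S_k` of finite sums
`Σ (a_{ijn}(y) cos nφ + b_{ijn}(y) sin nφ) (ln^i ρ)/ρ^j`, `j ≥ k`, with smooth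
exponentially decaying coefficients. -/
def MemS (φ : ℝ → ℝ → ℝ) (k : ℕ) (S : ℝ → ℝ → ℝ) : Prop :=
  ∃ (N I J : ℕ) (A B : ℕ → ℕ → ℕ → ℝ → ℝ),
    (∀ i j n : ℕ, ExpDecayAll (A i j n) ∧ ExpDecayAll (B i j n)) ∧
    ∀ ρ y : ℝ, 0 < ρ → S ρ y =
      ∑ n ∈ Finset.range (N + 1), ∑ i ∈ Finset.range (I + 1), ∑ j ∈ Finset.Icc k J,
        (A i j n y * Real.cos (n * φ ρ y) + B i j n y * Real.sin (n * φ ρ y)) *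
          (Real.log ρ) ^ i / ρ ^ j

/-- The subclass `S°_k ⊆ S_k` with no resonant `n = 1` terms at the lowest power
`j = k`: `a_{ik1} = b_{ik1} = 0` for all `i`. -/
def MemS0 (φ : ℝ → ℝ → ℝ) (k : ℕ) (S : ℝ → ℝ → ℝ) : Prop :=
  ∃ (N I J : ℕ) (A B : ℕ → ℕ → ℕ → ℝ → ℝ),
    (∀ i j n : ℕ, ExpDecayAll (A i j n) ∧ ExpDecayAll (B i j n)) ∧
    (∀ i : ℕ, (∀ y : ℝ, A i k 1 y = 0) ∧ (∀ y : ℝ, B i k 1 y = 0)) ∧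
    ∀ ρ y : ℝ, 0 < ρ → S ρ y =
      ∑ n ∈ Finset.range (N + 1), ∑ i ∈ Finset.range (I + 1), ∑ j ∈ Finset.Icc k J,
        (A i j n y * Real.cos (n * φ ρ y) + B i j n y * Real.sin (n * φ ρ y)) *
          (Real.log ρ) ^ i / ρ ^ j

namespace ExpDecayAll

theorem zero : ExpDecayAll 0 :=
  ⟨contDiff_const, fun _ _ => ⟨0, fun y => by simp⟩⟩

theorem add {f g : ℝ → ℝ} (hf : ExpDecayAll f) (hg : ExpDecayAll g) : ExpDecayAll (f + g) := by
  refine ⟨hf.1.add hg.1, fun N l => ?_⟩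
  obtain ⟨C, hC⟩ := hf.2 N l
  obtain ⟨D, hD⟩ := hg.2 N l
  refine ⟨C + D, fun y => ?_⟩
  rw [iteratedDeriv_add (hf.1.of_le (mod_cast le_top)).contDiffAt
    (hg.1.of_le (mod_cast le_top)).contDiffAt, add_mul]
  exact (abs_add_le _ _).trans (add_le_add (hC y) (hD y))

theorem const_smul {f : ℝ → ℝ} (hf : ExpDecayAll f) (c : ℝ) : ExpDecayAll (c • f) := by
  refine ⟨contDiff_const.smul hf.1, fun N l => ?_⟩
  obtain ⟨C, hC⟩ := hf.2 N l
  refine ⟨|c| * C, fun y => ?_⟩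
  rw [iteratedDeriv_const_smul_field, smul_eq_mul, abs_mul, mul_assoc]
  exact mul_le_mul_of_nonneg_left (hC y) (abs_nonneg c)

theorem mul {f g : ℝ → ℝ} (hf : ExpDecayAll f) (hg : ExpDecayAll g) : ExpDecayAll (f * g) := by
  refine ⟨hf.1.mul hg.1, fun N l => ?_⟩
  choose C hC using hf.2 N
  choose D hD using hg.2 0
  refine ⟨∑ i ∈ Finset.range (l + 1), (l.choose i : ℝ) * C i * D (l - i), fun y => ?_⟩
  have h := norm_iteratedFDeriv_mul_le hf.1 hg.1 y (n := l) (mod_cast le_top)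
  simp only [norm_iteratedFDeriv_eq_norm_iteratedDeriv, Real.norm_eq_abs] at h
  refine h.trans ?_
  rw [Finset.sum_mul]
  refine Finset.sum_le_sum fun i _ => ?_
  have hDy : |iteratedDeriv (l - i) g y| ≤ D (l - i) := by simpa using hD (l - i) y
  calc (l.choose i : ℝ) * |iteratedDeriv i f y| * |iteratedDeriv (l - i) g y|
      ≤ (l.choose i : ℝ) * (C i * Real.exp (-(N : ℝ) * |y|)) * D (l - i) := by
        have hC' := hC i y
        have hpos := (abs_nonneg _).trans hC'
        gcongr
    _ = _ := by ring

end ExpDecayAll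

/-- A single oscillatory term `(A cos nφ + B sin nφ) (ln^i ρ)/ρ^j`. -/
noncomputable def modeTerm (φ : ℝ → ℝ → ℝ) (A B : ℝ → ℝ) (n i j : ℕ) (ρ y : ℝ) : ℝ :=
  (A y * Real.cos (n * φ ρ y) + B y * Real.sin (n * φ ρ y)) * (Real.log ρ) ^ i / ρ ^ j

/-- The functions in `S_k` whose coefficients vanish at all indices `(j, n)` with `P j n`. -/
def MemSAvoiding (P : ℕ → ℕ → Prop) (φ : ℝ → ℝ → ℝ) (k : ℕ) (S : ℝ → ℝ → ℝ) : Prop :=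
  ∃ (N I J : ℕ) (A B : ℕ → ℕ → ℕ → ℝ → ℝ),
    (∀ i j n : ℕ, ExpDecayAll (A i j n) ∧ ExpDecayAll (B i j n)) ∧
    (∀ i j n : ℕ, P j n → A i j n = 0 ∧ B i j n = 0) ∧
    ∀ ρ y : ℝ, 0 < ρ → S ρ y =
      ∑ n ∈ Finset.range (N + 1), ∑ i ∈ Finset.range (I + 1), ∑ j ∈ Finset.Icc k J,
        modeTerm φ (A i j n) (B i j n) n i j ρ y

theorem memS_iff_memSAvoiding {φ : ℝ → ℝ → ℝ} {k : ℕ} {S : ℝ → ℝ → ℝ} :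
    MemS φ k S ↔ MemSAvoiding (fun _ _ => False) φ k S := by
  simp [MemS, MemSAvoiding, modeTerm]

theorem memS0_iff_memSAvoiding {φ : ℝ → ℝ → ℝ} {k : ℕ} {S : ℝ → ℝ → ℝ} :
    MemS0 φ k S ↔ MemSAvoiding (fun j n => j = k ∧ n = 1) φ k S := by
  have h (A B : ℕ → ℕ → ℕ → ℝ → ℝ) :
      (∀ i j n : ℕ, j = k ∧ n = 1 → A i j n = 0 ∧ B i j n = 0) ↔
        ∀ i : ℕ, (∀ y : ℝ, A i k 1 y = 0) ∧ (∀ y : ℝ, B i k 1 y = 0) := by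
    constructor
    · intro h i
      exact ⟨congrFun (h i k 1 ⟨rfl, rfl⟩).1, congrFun (h i k 1 ⟨rfl, rfl⟩).2⟩
    · rintro h i _ _ ⟨rfl, rfl⟩
      exact ⟨funext (h i).1, funext (h i).2⟩
  simp only [MemS0, MemSAvoiding, modeTerm, h]

namespace MemSAvoiding

variable {P : ℕ → ℕ → Prop} {φ : ℝ → ℝ → ℝ} {k : ℕ} {S T : ℝ → ℝ → ℝ}

theorem congr (hS : MemSAvoiding P φ k S) (h : ∀ ρ y : ℝ, 0 < ρ → T ρ y = S ρ y) :
    MemSAvoiding P φ k T := by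
  obtain ⟨N, I, J, A, B, hd, hP, hs⟩ := hS
  exact ⟨N, I, J, A, B, hd, hP, fun ρ y hρ => (h ρ y hρ).trans (hs ρ y hρ)⟩

theorem exists_uniform_sum (hS : MemSAvoiding P φ k S) :
    ∃ (N I J : ℕ) (A B : ℕ → ℕ → ℕ → ℝ → ℝ),
      (∀ i j n : ℕ, ExpDecayAll (A i j n) ∧ ExpDecayAll (B i j n)) ∧
      (∀ i j n : ℕ, P j n → A i j n = 0 ∧ B i j n = 0) ∧
      ∀ N' I' J' : ℕ, N ≤ N' → I ≤ I' → J ≤ J' → ∀ ρ y : ℝ, 0 < ρ → S ρ y =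
        ∑ n ∈ Finset.range (N' + 1), ∑ i ∈ Finset.range (I' + 1), ∑ j ∈ Finset.Icc k J',
          modeTerm φ (A i j n) (B i j n) n i j ρ y := by
  obtain ⟨N, I, J, A, B, hd, hP, hs⟩ := hS
  let cut (F : ℕ → ℕ → ℕ → ℝ → ℝ) (i j n : ℕ) : ℝ → ℝ :=
    if n ≤ N ∧ i ≤ I ∧ j ≤ J then F i j n else 0
  refine ⟨N, I, J, cut A, cut B, fun i j n => ?_, fun i j n h => ?_, ?_⟩
  · simp only [cut]
    split_ifs
    exacts [hd i j n, ⟨.zero, .zero⟩]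
  · simp only [cut]
    split_ifs
    exacts [hP i j n h, ⟨rfl, rfl⟩]
  · intro N' I' J' hN hI hJ ρ y hρ
    have hzero (n i j : ℕ) (h : ¬(n ≤ N ∧ i ≤ I ∧ j ≤ J)) :
        modeTerm φ (cut A i j n) (cut B i j n) n i j ρ y = 0 := by
      simp [cut, modeTerm, h]
    rw [hs ρ y hρ, ← Finset.sum_subset (Finset.range_subset_range.2 (Nat.succ_le_succ hN))]
    · refine Finset.sum_congr rfl fun n hn => ?_
      rw [← Finset.sum_subset (Finset.range_subset_range.2 (Nat.succ_le_succ hI))]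
      · refine Finset.sum_congr rfl fun i hi => ?_
        rw [← Finset.sum_subset (Finset.Icc_subset_Icc_right hJ)]
        · refine Finset.sum_congr rfl fun j hj => ?_
          have h : n ≤ N ∧ i ≤ I ∧ j ≤ J := by
            simp only [Finset.mem_range, Finset.mem_Icc] at hn hi hj
            omega
          simp [cut, h]
        · intro j hj hj'
          refine hzero _ _ _ ?_
          simp only [Finset.mem_Icc] at hj hj'
          omega
      · intro i _ hi
        refine Finset.sum_eq_zero fun j _ => hzero _ _ _ ?_
        simp only [Finset.mem_range] at hi
        omega
    · intro n _ hn
      refine Finset.sum_eq_zero fun i _ => Finset.sum_eq_zero fun j _ => hzero _ _ _ ?_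
      simp only [Finset.mem_range] at hn
      omega

theorem add (hS : MemSAvoiding P φ k S) (hT : MemSAvoiding P φ k T) :
    MemSAvoiding P φ k (S + T) := by
  obtain ⟨N, I, J, A, B, hd, hP, hs⟩ := hS.exists_uniform_sum
  obtain ⟨N', I', J', A', B', hd', hP', hs'⟩ := hT.exists_uniform_sum
  refine ⟨max N N', max I I', max J J', fun i j n => A i j n + A' i j n,
    fun i j n => B i j n + B' i j n,
    fun i j n => ⟨(hd i j n).1.add (hd' i j n).1, (hd i j n).2.add (hd' i j n).2⟩,
    fun i j n h => by simp [hP i j n h, hP' i j n h], fun ρ y hρ => ?_⟩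
  rw [Pi.add_apply, Pi.add_apply,
    hs _ _ _ (le_max_left N N') (le_max_left I I') (le_max_left J J') ρ y hρ,
    hs' _ _ _ (le_max_right N N') (le_max_right I I') (le_max_right J J') ρ y hρ]
  simp only [← Finset.sum_add_distrib]
  refine Finset.sum_congr rfl fun n _ => Finset.sum_congr rfl fun i _ =>
    Finset.sum_congr rfl fun j _ => ?_
  simp only [modeTerm, Pi.add_apply]
  ring

theorem zero : MemSAvoiding P φ k 0 :=
  ⟨0, 0, 0, 0, 0, fun _ _ _ => ⟨.zero, .zero⟩, fun _ _ _ _ => ⟨rfl, rfl⟩,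
    fun ρ y _ => by simp [modeTerm]⟩

theorem neg (hS : MemSAvoiding P φ k S) : MemSAvoiding P φ k (-S) := by
  obtain ⟨N, I, J, A, B, hd, hP, hs⟩ := hS
  refine ⟨N, I, J, fun i j n => (-1 : ℝ) • A i j n, fun i j n => (-1 : ℝ) • B i j n,
    fun i j n => ⟨(hd i j n).1.const_smul _, (hd i j n).2.const_smul _⟩,
    fun i j n h => by simp [hP i j n h], fun ρ y hρ => ?_⟩
  rw [Pi.neg_apply, Pi.neg_apply, hs ρ y hρ]
  simp only [← Finset.sum_neg_distrib]
  refine Finset.sum_congr rfl fun n _ => Finset.sum_congr rfl fun i _ =>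
    Finset.sum_congr rfl fun j _ => ?_
  simp only [modeTerm, Pi.smul_apply, smul_eq_mul]
  ring

theorem modeTerm {A B : ℝ → ℝ} (hA : ExpDecayAll A) (hB : ExpDecayAll B) {n i j : ℕ}
    (hj : k ≤ j) (hP : ¬P j n) : MemSAvoiding P φ k (modeTerm φ A B n i j) := by
  let single (F : ℝ → ℝ) (i' j' n' : ℕ) : ℝ → ℝ := if n' = n ∧ i' = i ∧ j' = j then F else 0
  refine ⟨n, i, j, single A, single B, fun i' j' n' => ?_, fun i' j' n' h => ?_, fun ρ y _ => ?_⟩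
  · simp only [single]
    split_ifs
    exacts [⟨hA, hB⟩, ⟨.zero, .zero⟩]
  · simp only [single]
    split_ifs with h'
    · obtain ⟨rfl, rfl, rfl⟩ := h'
      exact absurd h hP
    · exact ⟨rfl, rfl⟩
  · rw [Finset.sum_eq_single_of_mem n (by simp), Finset.sum_eq_single_of_mem i (by simp),
      Finset.sum_eq_single_of_mem j (by simp [hj])]
    · simp [single]
    · intro j' _ h
      simp [single, h, _root_.modeTerm]
    · intro i' _ h
      simp [single, h, _root_.modeTerm]
    · intro n' _ h
      simp [single, h, _root_.modeTerm]

theorem induction {Q : (ℝ → ℝ → ℝ) → Prop} (hS : MemSAvoiding P φ k S)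
    (zero : Q 0) (add : ∀ S T, Q S → Q T → Q (S + T))
    (congr : ∀ S T, (∀ ρ y : ℝ, 0 < ρ → T ρ y = S ρ y) → Q S → Q T)
    (term : ∀ (A B : ℝ → ℝ) (n i j : ℕ), ExpDecayAll A → ExpDecayAll B → k ≤ j → ¬P j n →
      Q (_root_.modeTerm φ A B n i j)) : Q S := by
  obtain ⟨N, I, J, A, B, hd, hP, hs⟩ := hS
  refine congr (∑ n ∈ Finset.range (N + 1), ∑ i ∈ Finset.range (I + 1), ∑ j ∈ Finset.Icc k J,
    _root_.modeTerm φ (A i j n) (B i j n) n i j) S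
    (fun ρ y hρ => by simpa only [Finset.sum_apply] using hs ρ y hρ) ?_
  refine Finset.sum_induction _ Q add zero fun n _ => Finset.sum_induction _ Q add zero fun i _ =>
    Finset.sum_induction _ Q add zero fun j hj => ?_
  by_cases h : P j n
  · refine congr 0 _ (fun ρ y _ => ?_) zero
    simp [hP i j n h, _root_.modeTerm]
  · exact term _ _ _ _ _ (hd i j n).1 (hd i j n).2 (Finset.mem_Icc.1 hj).1 h

theorem mono {P' : ℕ → ℕ → Prop} {k' : ℕ} (hS : MemSAvoiding P φ k S)
    (h : ∀ j n, k ≤ j → ¬P j n → k' ≤ j ∧ ¬P' j n) : MemSAvoiding P' φ k' S :=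
  hS.induction .zero (fun _ _ => .add) (fun _ _ h hS => hS.congr h)
    fun _ _ n _ j hA hB hj hP => .modeTerm hA hB (h j n hj hP).1 (h j n hj hP).2

end MemSAvoiding

theorem modeTerm_mul_cos (φ : ℝ → ℝ → ℝ) (A B : ℝ → ℝ) (n i j : ℕ) (ρ y : ℝ) :
    modeTerm φ A B n i j ρ y * Real.cos (φ ρ y) =
      modeTerm φ ((1 / 2 : ℝ) • A) ((1 / 2 : ℝ) • B) (n + 1) i j ρ y +
        if n = 0 then modeTerm φ ((1 / 2 : ℝ) • A) ((-1 / 2 : ℝ) • B) 1 i j ρ y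
        else modeTerm φ ((1 / 2 : ℝ) • A) ((1 / 2 : ℝ) • B) (n - 1) i j ρ y := by
  rcases n with _ | n
  · simp [modeTerm]
    ring
  · have h₁ : ((n + 1 + 1 : ℕ) : ℝ) * φ ρ y = ((n + 1 : ℕ) : ℝ) * φ ρ y + φ ρ y := by
      push_cast
      ring
    have h₂ : (n : ℝ) * φ ρ y = ((n + 1 : ℕ) : ℝ) * φ ρ y - φ ρ y := by
      push_cast
      ring
    simp only [modeTerm, Nat.add_sub_cancel, Nat.add_eq_zero_iff, one_ne_zero, and_false, if_false,
      h₁, h₂, Real.cos_add, Real.sin_add, Real.cos_sub, Real.sin_sub, Pi.smul_apply, smul_eq_mul]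
    ring

theorem MemSAvoiding.mul_cos {φ : ℝ → ℝ → ℝ} {k : ℕ} {S : ℝ → ℝ → ℝ}
    (hS : MemSAvoiding (fun _ _ => False) φ k S) :
    MemSAvoiding (fun _ _ => False) φ k (fun ρ y => S ρ y * Real.cos (φ ρ y)) := by
  refine hS.induction (Q := fun S => MemSAvoiding _ φ k fun ρ y => S ρ y * Real.cos (φ ρ y))
    ?_ ?_ ?_ ?_
  · exact MemSAvoiding.zero.congr fun ρ y _ => by simp
  · exact fun S T hS hT => (hS.add hT).congr fun ρ y _ => by simp [add_mul]
  · exact fun S T h hS => hS.congr fun ρ y hρ => by rw [h ρ y hρ]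
  · intro A B n i j hA hB hj _
    have key (C D : ℝ) (m : ℕ) : MemSAvoiding (fun _ _ => False) φ k
        (_root_.modeTerm φ (C • A) (D • B) m i j) :=
      .modeTerm (hA.const_smul _) (hB.const_smul _) hj not_false
    by_cases h : n = 0
    · exact ((key _ _ _).add (key _ _ _)).congr fun ρ y _ => by
        rw [modeTerm_mul_cos, if_pos h]; rfl
    · exact ((key _ _ _).add (key _ _ _)).congr fun ρ y _ => by
        rw [modeTerm_mul_cos, if_neg h]; rfl

section Phase

variable {φ : ℝ → ℝ → ℝ} {δ : ℝ → ℝ}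

/-- The `ρ`-derivative of `modeTerm φ A B n i j` when `∂φ/∂ρ = 1 + δ/ρ`. -/
noncomputable def modeTermDeriv (φ : ℝ → ℝ → ℝ) (δ A B : ℝ → ℝ) (n i j : ℕ) (ρ y : ℝ) : ℝ :=
  -(j * modeTerm φ A B n i (j + 1) ρ y) + i * modeTerm φ A B n (i - 1) (j + 1) ρ y +
    n * (1 + δ y / ρ) * modeTerm φ B (-A) n i j ρ y

theorem hasDerivAt_modeTerm
    (hφ : ∀ ρ y : ℝ, 0 < ρ → HasDerivAt (fun r => φ r y) (1 + δ y / ρ) ρ)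
    (A B : ℝ → ℝ) (n i j : ℕ) {ρ : ℝ} (hρ : 0 < ρ) (y : ℝ) :
    HasDerivAt (fun r => modeTerm φ A B n i j r y) (modeTermDeriv φ δ A B n i j ρ y) ρ := by
  have hp := (hφ ρ y hρ).const_mul (n : ℝ)
  have h := ((((hp.cos.const_mul (A y)).add (hp.sin.const_mul (B y))).mul
    ((Real.hasDerivAt_log hρ.ne').pow i)).div (hasDerivAt_pow j ρ) (pow_ne_zero j hρ.ne'))
  refine h.congr_deriv ?_
  have hj : (j : ℝ) * ρ ^ (j - 1) = j * ρ ^ j / ρ := by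
    rcases j with _ | j
    · simp
    · field_simp
      simp [pow_succ]
  simp only [modeTermDeriv, modeTerm, Pi.add_apply, Pi.mul_apply, Pi.pow_apply, Pi.neg_apply, hj]
  field_simp
  ring

/-- The second `ρ`-derivative of `modeTerm φ A B n i j` when `∂φ/∂ρ = 1 + δ/ρ`. -/
noncomputable def modeTermDeriv₂ (φ : ℝ → ℝ → ℝ) (δ A B : ℝ → ℝ) (n i j : ℕ) (ρ y : ℝ) : ℝ :=
  -(j * modeTermDeriv φ δ A B n i (j + 1) ρ y) +
    i * modeTermDeriv φ δ A B n (i - 1) (j + 1) ρ y +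
    (n * (-(δ y) / ρ ^ 2) * modeTerm φ B (-A) n i j ρ y +
      n * (1 + δ y / ρ) * modeTermDeriv φ δ B (-A) n i j ρ y)

theorem hasDerivAt_modeTermDeriv
    (hφ : ∀ ρ y : ℝ, 0 < ρ → HasDerivAt (fun r => φ r y) (1 + δ y / ρ) ρ)
    (A B : ℝ → ℝ) (n i j : ℕ) {ρ : ℝ} (hρ : 0 < ρ) (y : ℝ) :
    HasDerivAt (fun r => modeTermDeriv φ δ A B n i j r y)
      (modeTermDeriv₂ φ δ A B n i j ρ y) ρ := by
  have hfreq : HasDerivAt (fun r => (n : ℝ) * (1 + δ y / r)) (n * (-(δ y) / ρ ^ 2)) ρ := by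
    have h := (((hasDerivAt_inv hρ.ne').const_mul (δ y)).const_add 1).const_mul (n : ℝ)
    refine (h.congr_deriv ?_)
    ring
  exact (((hasDerivAt_modeTerm hφ A B n i (j + 1) hρ y).const_mul (j : ℝ)).neg.add
    ((hasDerivAt_modeTerm hφ A B n (i - 1) (j + 1) hρ y).const_mul (i : ℝ))).add
    (hfreq.mul (hasDerivAt_modeTerm hφ B (-A) n i j hρ y))

theorem exists_remainder_modeTermDeriv₂ (hδ : ExpDecayAll δ) {A B : ℝ → ℝ}
    (hA : ExpDecayAll A) (hB : ExpDecayAll B) (n i j : ℕ) :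
    ∃ T, MemSAvoiding (fun _ _ => False) φ (j + 2) T ∧ ∀ ρ y : ℝ, 0 < ρ →
      modeTermDeriv₂ φ δ A B n i j ρ y + (1 + 1 / (4 * ρ ^ 2)) * modeTerm φ A B n i j ρ y =
        (1 - (n : ℝ) ^ 2) * modeTerm φ A B n i j ρ y +
        modeTerm φ ((-2 * n * j : ℝ) • B + (-2 * n ^ 2 : ℝ) • (δ * A))
          ((2 * n * j : ℝ) • A + (-2 * n ^ 2 : ℝ) • (δ * B)) n i (j + 1) ρ y +
        modeTerm φ ((2 * n * i : ℝ) • B) ((-2 * n * i : ℝ) • A) n (i - 1) (j + 1) ρ y +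
        T ρ y := by
  have hδA := hδ.mul hA
  have hδB := hδ.mul hB
  refine ⟨_, ((MemSAvoiding.modeTerm (n := n) (i := i) (j := j + 2)
    (((hA.const_smul (j * (j + 1) + 1 / 4 : ℝ)).add (hδB.const_smul (-(n * (2 * j + 1)) : ℝ))).add
      ((hδ.mul hδA).const_smul (-n ^ 2 : ℝ)))
    (((hB.const_smul (j * (j + 1) + 1 / 4 : ℝ)).add (hδA.const_smul (n * (2 * j + 1) : ℝ))).add
      ((hδ.mul hδB).const_smul (-n ^ 2 : ℝ))) le_rfl not_false).add
    (.modeTerm (n := n) (i := i - 1) (j := j + 2)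
      ((hA.const_smul (-((2 * j + 1) * i) : ℝ)).add (hδB.const_smul (2 * n * i : ℝ)))
      ((hB.const_smul (-((2 * j + 1) * i) : ℝ)).add (hδA.const_smul (-(2 * n * i) : ℝ)))
      le_rfl not_false)).add
    (.modeTerm (n := n) (i := i - 1 - 1) (j := j + 2)
      (hA.const_smul (i * (i - 1 : ℕ) : ℝ)) (hB.const_smul (i * (i - 1 : ℕ) : ℝ))
      le_rfl not_false), fun ρ y hρ => ?_⟩
  simp only [modeTermDeriv₂, modeTermDeriv, modeTerm, Pi.add_apply, Pi.mul_apply, Pi.neg_apply,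
    Pi.smul_apply, smul_eq_mul, Nat.cast_add, Nat.cast_one]
  field_simp
  ring

/-- `R` is in the range of `L₀` on `S_k` modulo `S°_{k+1}`. -/
def SolvableModS0 (φ : ℝ → ℝ → ℝ) (δ : ℝ → ℝ) (k : ℕ) (R : ℝ → ℝ → ℝ) : Prop :=
  ∃ W W₁ W₂ S' : ℝ → ℝ → ℝ, MemSAvoiding (fun _ _ => False) φ k W ∧
    MemSAvoiding (fun j n => j = k + 1 ∧ n = 1) φ (k + 1) S' ∧
    ∀ ρ y : ℝ, 0 < ρ → HasDerivAt (fun r => W r y) (W₁ ρ y) ρ ∧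
      HasDerivAt (fun r => W₁ r y) (W₂ ρ y) ρ ∧
      W₂ ρ y + (1 + 1 / (4 * ρ ^ 2) + 8 * δ y / ρ * (Real.cos (φ ρ y)) ^ 2) * W ρ y
        = R ρ y + S' ρ y

namespace SolvableModS0

variable {k : ℕ} {R T : ℝ → ℝ → ℝ}

theorem congr (hR : SolvableModS0 φ δ k R) (h : ∀ ρ y : ℝ, 0 < ρ → T ρ y = R ρ y) :
    SolvableModS0 φ δ k T := by
  obtain ⟨W, W₁, W₂, S', hW, hS', hL⟩ := hR
  exact ⟨W, W₁, W₂, S', hW, hS', fun ρ y hρ => by rw [h ρ y hρ]; exact hL ρ y hρ⟩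

theorem add (hR : SolvableModS0 φ δ k R) (hT : SolvableModS0 φ δ k T) :
    SolvableModS0 φ δ k (R + T) := by
  obtain ⟨W, W₁, W₂, S', hW, hS', hL⟩ := hR
  obtain ⟨V, V₁, V₂, T', hV, hT', hM⟩ := hT
  refine ⟨W + V, W₁ + V₁, W₂ + V₂, S' + T', hW.add hV, hS'.add hT', fun ρ y hρ =>
    ⟨(hL ρ y hρ).1.add (hM ρ y hρ).1, (hL ρ y hρ).2.1.add (hM ρ y hρ).2.1, ?_⟩⟩
  have h₁ := (hL ρ y hρ).2.2
  have h₂ := (hM ρ y hρ).2.2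
  simp only [Pi.add_apply]
  linear_combination h₁ + h₂

theorem of_memSAvoiding (hR : MemSAvoiding (fun j n => j = k + 1 ∧ n = 1) φ (k + 1) R) :
    SolvableModS0 φ δ k R :=
  ⟨0, 0, 0, -R, .zero, hR.neg, fun ρ y _ =>
    ⟨hasDerivAt_const ρ 0, hasDerivAt_const ρ 0, by simp⟩⟩

theorem zero : SolvableModS0 φ δ k 0 := of_memSAvoiding .zero

theorem of_modeTerm
    (hφ : ∀ ρ y : ℝ, 0 < ρ → HasDerivAt (fun r => φ r y) (1 + δ y / ρ) ρ)
    {A B : ℝ → ℝ} (hA : ExpDecayAll A) (hB : ExpDecayAll B) (n i : ℕ)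
    (h : ∀ ρ y : ℝ, 0 < ρ → R ρ y = modeTermDeriv₂ φ δ A B n i k ρ y +
      (1 + 1 / (4 * ρ ^ 2) + 8 * δ y / ρ * (Real.cos (φ ρ y)) ^ 2) * modeTerm φ A B n i k ρ y) :
    SolvableModS0 φ δ k R :=
  ⟨modeTerm φ A B n i k, modeTermDeriv φ δ A B n i k, modeTermDeriv₂ φ δ A B n i k, 0,
    .modeTerm hA hB le_rfl not_false, .zero, fun ρ y hρ =>
      ⟨hasDerivAt_modeTerm hφ A B n i k hρ y, hasDerivAt_modeTermDeriv hφ A B n i k hρ y, by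
        rw [h ρ y hρ]; simp⟩⟩

theorem resonant
    (hφ : ∀ ρ y : ℝ, 0 < ρ → HasDerivAt (fun r => φ r y) (1 + δ y / ρ) ρ)
    (hδ : ExpDecayAll δ) (hk : 1 ≤ k) (i : ℕ) {P Q : ℝ → ℝ}
    (hP : ExpDecayAll P) (hQ : ExpDecayAll Q) :
    SolvableModS0 φ δ k (modeTerm φ P Q 1 i (k + 1)) := by
  have hk' : (k : ℝ) ≠ 0 := by positivity
  have step (i : ℕ) (hprev : ∀ {A B : ℝ → ℝ}, ExpDecayAll A → ExpDecayAll B →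
      SolvableModS0 φ δ k (modeTerm φ ((i : ℝ) • A) ((i : ℝ) • B) 1 (i - 1) (k + 1)))
      {P Q : ℝ → ℝ} (hP : ExpDecayAll P) (hQ : ExpDecayAll Q) :
      SolvableModS0 φ δ k (modeTerm φ P Q 1 i (k + 1)) := by
    obtain ⟨A, hA, hAQ⟩ : ∃ A, ExpDecayAll A ∧ ∀ y, A y = Q y / (2 * k) :=
      ⟨_, hQ.const_smul (1 / (2 * k) : ℝ), fun y => by
        simp only [Pi.smul_apply, smul_eq_mul]; ring⟩
    obtain ⟨B, hB, hBP⟩ : ∃ B, ExpDecayAll B ∧ ∀ y, B y = (4 * δ y * A y - P y) / (2 * k) :=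
      ⟨_, ((hδ.mul hA).const_smul (2 / k : ℝ)).add (hP.const_smul (-1 / (2 * k) : ℝ)), fun y => by
        simp only [Pi.add_apply, Pi.mul_apply, Pi.smul_apply, smul_eq_mul]; field_simp; ring⟩
    obtain ⟨T, hT, hL⟩ := exists_remainder_modeTermDeriv₂ (φ := φ) hδ hA hB 1 i k
    have hT' : SolvableModS0 φ δ k (-T) :=
      of_memSAvoiding (hT.neg.mono fun j n hj _ => ⟨by omega, by omega⟩)
    have hthird : SolvableModS0 φ δ k
        (modeTerm φ ((-2 : ℝ) • (δ * A)) ((-2 : ℝ) • (δ * B)) 3 i (k + 1)) :=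
      of_memSAvoiding (.modeTerm ((hδ.mul hA).const_smul _) ((hδ.mul hB).const_smul _) le_rfl
        (by omega))
    refine ((((of_modeTerm hφ hA hB 1 i fun _ _ _ => rfl).add
      (hprev (hB.const_smul (-2)) (hA.const_smul 2))).add hthird).add hT').congr fun ρ y hρ => ?_
    have hLy := hL ρ y hρ
    have hPy : P y = 4 * δ y * A y - 2 * k * B y := by
      rw [hBP]; field_simp; ring
    have hQy : Q y = 2 * k * A y := by
      rw [hAQ]; field_simp
    have hcos : Real.cos (3 * φ ρ y) = 4 * Real.cos (φ ρ y) ^ 3 - 3 * Real.cos (φ ρ y) :=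
      Real.cos_three_mul _
    have hsin : Real.sin (3 * φ ρ y) =
        4 * (Real.sin (φ ρ y) * Real.cos (φ ρ y) ^ 2) - Real.sin (φ ρ y) := by
      rw [Real.sin_three_mul, Real.cos_sq']; ring
    simp only [Pi.add_apply, Pi.neg_apply]
    rw [show ∀ a b c d : ℝ, a + (b + c) * d = a + b * d + c * d by intros; ring, hLy]
    simp only [modeTerm, Pi.add_apply, Pi.mul_apply, Pi.smul_apply, smul_eq_mul, Nat.cast_one,
      one_mul, Nat.cast_ofNat, hcos, hsin, hPy, hQy]
    field_simp
    ring
  induction i generalizing P Q with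
  | zero =>
    exact step 0 (fun _ _ => zero.congr fun ρ y _ => by simp [modeTerm]) hP hQ
  | succ i ih =>
    exact step (i + 1) (fun hA hB => ih (hA.const_smul _) (hB.const_smul _)) hP hQ

theorem of_memS_succ
    (hφ : ∀ ρ y : ℝ, 0 < ρ → HasDerivAt (fun r => φ r y) (1 + δ y / ρ) ρ)
    (hδ : ExpDecayAll δ) (hk : 1 ≤ k) (hR : MemSAvoiding (fun _ _ => False) φ (k + 1) R) :
    SolvableModS0 φ δ k R := by
  refine hR.induction zero (fun _ _ => add) (fun _ _ h hS => hS.congr h) ?_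
  intro A B n i j hA hB hj _
  by_cases h : j = k + 1 ∧ n = 1
  · obtain ⟨rfl, rfl⟩ := h
    exact resonant hφ hδ hk i hA hB
  · exact of_memSAvoiding (.modeTerm hA hB hj h)

theorem of_memS0
    (hφ : ∀ ρ y : ℝ, 0 < ρ → HasDerivAt (fun r => φ r y) (1 + δ y / ρ) ρ)
    (hδ : ExpDecayAll δ) (hk : 1 ≤ k)
    (hR : MemSAvoiding (fun j n => j = k ∧ n = 1) φ k R) :
    SolvableModS0 φ δ k R := by
  refine hR.induction zero (fun _ _ => add) (fun _ _ h hS => hS.congr h) ?_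
  intro A B n i j hA hB hj h
  by_cases hjk : j = k
  · subst hjk
    have hn : (1 - (n : ℝ) ^ 2) ≠ 0 := by
      have hn1 : n ≠ 1 := fun hn => h ⟨rfl, hn⟩
      rw [sub_ne_zero, ne_comm, sq_ne_one_iff]
      exact ⟨mod_cast hn1, by linarith [n.cast_nonneg (α := ℝ)]⟩
    obtain ⟨A', hA', hAA'⟩ : ∃ A', ExpDecayAll A' ∧ ∀ y, A y = (1 - (n : ℝ) ^ 2) * A' y :=
      ⟨_, hA.const_smul (1 / (1 - (n : ℝ) ^ 2)), fun y => by
        simp only [Pi.smul_apply, smul_eq_mul]; field_simp⟩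
    obtain ⟨B', hB', hBB'⟩ : ∃ B', ExpDecayAll B' ∧ ∀ y, B y = (1 - (n : ℝ) ^ 2) * B' y :=
      ⟨_, hB.const_smul (1 / (1 - (n : ℝ) ^ 2)), fun y => by
        simp only [Pi.smul_apply, smul_eq_mul]; field_simp⟩
    have hδA := hδ.mul hA'
    have hδB := hδ.mul hB'
    obtain ⟨T, hT, hL⟩ := exists_remainder_modeTermDeriv₂ (φ := φ) hδ hA' hB' n i j
    have hpot : MemSAvoiding (fun _ _ => False) φ (j + 1) (modeTerm φ ((8 : ℝ) • (δ * A'))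
        ((8 : ℝ) • (δ * B')) n i (j + 1)) :=
      .modeTerm (hδA.const_smul _) (hδB.const_smul _) le_rfl not_false
    have hrest := (((MemSAvoiding.modeTerm (P := fun _ _ => False) (φ := φ) (n := n) (i := i)
      ((hB'.const_smul (-2 * n * j : ℝ)).add (hδA.const_smul (-2 * n ^ 2 : ℝ)))
      ((hA'.const_smul (2 * n * j : ℝ)).add (hδB.const_smul (-2 * n ^ 2 : ℝ)))
      (le_refl (j + 1)) not_false).add
      (.modeTerm (n := n) (i := i - 1) (hB'.const_smul (2 * n * i : ℝ))
        (hA'.const_smul (-2 * n * i : ℝ)) le_rfl not_false)).add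
      (hT.mono fun j n hj hP => ⟨by omega, hP⟩)).add hpot.mul_cos.mul_cos
    refine ((of_modeTerm hφ hA' hB' n i fun _ _ _ => rfl).add
      (of_memS_succ hφ hδ hk hrest.neg)).congr fun ρ y hρ => ?_
    have hLy := hL ρ y hρ
    simp only [Pi.add_apply, Pi.neg_apply]
    rw [show ∀ a b c d : ℝ, a + (b + c) * d = a + b * d + c * d by intros; ring, hLy]
    simp only [modeTerm, Pi.add_apply, Pi.mul_apply, Pi.smul_apply, smul_eq_mul, hAA', hBB']
    field_simp
    ring
  · exact of_memS_succ hφ hδ hk (.modeTerm hA hB (by omega) not_false)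

end SolvableModS0

end Phase

/-- Inversion of the linearized operator `L₀ W = ∂_ρ²W + (1 + 1/(4ρ²) + 8δ(y)ρ^{-1}cos²φ)W`
on the asymptotic classes: for every `k ≥ 1` and `Σ° ∈ S°_k` there are `Σ_k ∈ S_k` and
`Σ°' ∈ S°_{k+1}` with `L₀Σ_k = Σ° + Σ°'`. -/
theorem L0_inversion_on_classes (β : ℝ) (a b₁ : ℝ → ℝ) (b₀ : ℝ)
    (ha : ContDiff ℝ (⊤ : ℕ∞) a) (hb₁ : ContDiff ℝ (⊤ : ℕ∞) b₁)
    (hdecay : ∀ N l : ℕ, ∃ C : ℝ, ∀ y : ℝ,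
      |iteratedDeriv l a y| + |iteratedDeriv l b₁ y| ≤ C * Real.exp (-(N : ℝ) * |y|))
    (δ : ℝ → ℝ) (hδ : ∀ y, δ y = (3 / 8) * β * (a y) ^ 2)
    (φ : ℝ → ℝ → ℝ) (hφ : ∀ ρ y, φ ρ y = ρ + δ y * Real.log ρ + (b₀ + b₁ y)) :
    ∀ k : ℕ, 1 ≤ k → ∀ S : ℝ → ℝ → ℝ, MemS0 φ k S →
      ∃ Sk S' : ℝ → ℝ → ℝ, MemS φ k Sk ∧ MemS0 φ (k + 1) S' ∧
        ∀ ρ y : ℝ, 0 < ρ →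
          deriv (deriv (fun r => Sk r y)) ρ
            + (1 + 1 / (4 * ρ ^ 2) + 8 * δ y / ρ * (Real.cos (φ ρ y)) ^ 2) * Sk ρ y
            = S ρ y + S' ρ y := by
  have ha' : ExpDecayAll a := by
    refine ⟨ha, fun N l => (hdecay N l).imp fun C hC y => ?_⟩
    exact (le_add_of_nonneg_right (abs_nonneg _)).trans (hC y)
  have hδ' : ExpDecayAll δ := by
    have h : δ = (3 / 8 * β) • (a * a) := by
      ext y
      simp only [hδ, Pi.smul_apply, Pi.mul_apply, smul_eq_mul]
      ring
    exact h ▸ (ha'.mul ha').const_smul _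
  have hφ' : ∀ ρ y : ℝ, 0 < ρ → HasDerivAt (fun r => φ r y) (1 + δ y / ρ) ρ := by
    intro ρ y hρ
    simp only [hφ]
    exact ((hasDerivAt_id ρ).add ((Real.hasDerivAt_log hρ.ne').const_mul (δ y))).add_const _
  intro k hk S hS
  obtain ⟨W, W₁, W₂, S', hW, hS', hL⟩ :=
    SolvableModS0.of_memS0 hφ' hδ' hk (memS0_iff_memSAvoiding.1 hS)
  refine ⟨W, S', memS_iff_memSAvoiding.2 hW, memS0_iff_memSAvoiding.2 hS', fun ρ y hρ => ?_⟩
  have hderiv : deriv (fun r => W r y) =ᶠ[nhds ρ] fun r => W₁ r y :=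
    (eventually_gt_nhds hρ).mono fun r hr => (hL r y hr).1.deriv
  rw [hderiv.deriv_eq, (hL ρ y hρ).2.1.deriv]
  exact (hL ρ y hρ).2.2
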